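/- Let I be a p_F-primary monomial ideal in k[ℕA], and let [b_1,F],…,[b_ℓ,F] be the distinct overlap classes of standard pairs of I that are maximal with respect to divisibility. For 1 ≤ i ≤ ℓ, let T_i = {c ∈ ℕA : c ∈ b + ℕF for some standard pair (b,F) of I whose overlap class divides [b_i,F]}. Then each ℕA ∖ T_i is the exponent set of a monomial ideal J_i of k[ℕA], J_i ⊇ I, each J_i is irreducible, I = J_1 ∩ ⋯ ∩ J_ℓ, and this decomposition is irredundant (for each i, ⋂_{j ≠ i} J_j is not contained in J_i). -/

import Mathlib

open scoped BigOperators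

namespace StdPairsPaper

/-- The coercion of a lattice point to a real vector. -/
def toR {d : ℕ} (v : Fin d → ℤ) : Fin d → ℝ := fun i => (v i : ℝ)

/-- The cone of nonnegative real combinations of (the real images of) elements of `S`. -/
def cone {d : ℕ} (S : Set (Fin d → ℤ)) : Set (Fin d → ℝ) :=
  {x | ∃ (t : Finset (Fin d → ℤ)) (c : (Fin d → ℤ) → ℝ),
    (t : Set (Fin d → ℤ)) ⊆ S ∧ (∀ v, 0 ≤ c v) ∧ x = ∑ v ∈ t, c v • toR v}

/-- `ℕS`, the submonoid of `ℤ^d` generated by `S`. -/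
def NSemi {d : ℕ} (S : Set (Fin d → ℤ)) : AddSubmonoid (Fin d → ℤ) :=
  AddSubmonoid.closure S

/-- `ℤS`, the subgroup of `ℤ^d` generated by `S`. -/
def ZGrp {d : ℕ} (S : Set (Fin d → ℤ)) : AddSubgroup (Fin d → ℤ) :=
  AddSubgroup.closure S

/-- `ℝS`, the real linear span of `S`. -/
def RSpan {d : ℕ} (S : Set (Fin d → ℤ)) : Submodule ℝ (Fin d → ℝ) :=
  Submodule.span ℝ (toR '' S)

/-- `A` is a configuration: a finite set of nonzero lattice points whose `ℤ`-span is `ℤ^d`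
and whose nonnegative real cone is strongly convex (contains no line, i.e. is pointed). -/
structure IsConfig {d : ℕ} (A : Set (Fin d → ℤ)) : Prop where
  (finite : A.Finite)
  (nonzero : (0 : Fin d → ℤ) ∉ A)
  (spans : ZGrp A = ⊤)
  (pointed : ∀ x ∈ cone A, -x ∈ cone A → x = 0)

/-- `F` is a face of the configuration `A`: `F ⊆ A`, the cone over `F` is an extreme
subset (face) of the cone over `A`, and `ℝ_{≥0}F ∩ A = F`. -/
def IsFace {d : ℕ} (A F : Set (Fin d → ℤ)) : Prop :=
  F ⊆ A ∧ IsExtreme ℝ (cone A) (cone F) ∧ cone F ∩ (toR '' A) = toR '' F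

/-- The set `a + ℕF`. -/
def cell {d : ℕ} (a : Fin d → ℤ) (F : Set (Fin d → ℤ)) : Set (Fin d → ℤ) :=
  {x | ∃ f ∈ NSemi F, x = a + f}

/-- Two pairs `(a,F)` and `(b,F)` belonging to the same face `F` overlap: `a - b ∈ ℤF`. -/
def Overlap {d : ℕ} (F : Set (Fin d → ℤ)) (a b : Fin d → ℤ) : Prop :=
  a - b ∈ ZGrp F

/-- The pair `(a,F)` divides the pair `(b,G)`:
there is `c ∈ ℕA` with `a + c + ℕF ⊆ b + ℕG`. -/
def PairDvd {d : ℕ} (A : Set (Fin d → ℤ)) (a : Fin d → ℤ) (F : Set (Fin d → ℤ))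
    (b : Fin d → ℤ) (G : Set (Fin d → ℤ)) : Prop :=
  ∃ c ∈ NSemi A, cell (a + c) F ⊆ cell b G

/-- `E` is the exponent set of a monomial ideal of `ℕA`: `E ⊆ ℕA` and `E + ℕA ⊆ E`. -/
def IsExpSet {d : ℕ} (A E : Set (Fin d → ℤ)) : Prop :=
  E ⊆ (NSemi A : Set (Fin d → ℤ)) ∧ ∀ e ∈ E, ∀ c ∈ NSemi A, e + c ∈ E

/-- The standard monomials of `E`: `ℕA ∖ E`. -/
def stdSet {d : ℕ} (A E : Set (Fin d → ℤ)) : Set (Fin d → ℤ) :=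
  (NSemi A : Set (Fin d → ℤ)) \ E

/-- `(a,F)` is a proper pair of `E`: a pair of `A` with `a + ℕF ⊆ std(E)`. -/
def ProperPair {d : ℕ} (A E : Set (Fin d → ℤ)) (a : Fin d → ℤ)
    (F : Set (Fin d → ℤ)) : Prop :=
  a ∈ NSemi A ∧ IsFace A F ∧ cell a F ⊆ stdSet A E

/-- `(a,F)` is a standard pair of `E`: a proper pair of `E` maximal with respect to
the partial order `(a,F) ≼ (b,G) ↔ a + ℕF ⊆ b + ℕG`. -/
def StdPair {d : ℕ} (A E : Set (Fin d → ℤ)) (a : Fin d → ℤ)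
    (F : Set (Fin d → ℤ)) : Prop :=
  ProperPair A E a F ∧
    ∀ b G, ProperPair A E b G → cell a F ⊆ cell b G → cell b G ⊆ cell a F

/-- The overlap class of the standard pair `(a,F)` of `E` is maximal with respect to
divisibility among overlap classes of standard pairs of `E`. -/
def MaxClass {d : ℕ} (A E : Set (Fin d → ℤ)) (a : Fin d → ℤ)
    (F : Set (Fin d → ℤ)) : Prop :=
  ∀ b G, StdPair A E b G → PairDvd A a F b G → PairDvd A b G a F

noncomputable section

/-- The affine semigroup ring `k[ℕA]`. -/
abbrev SGRing {d : ℕ} (k : Type*) [Field k] (A : Set (Fin d → ℤ)) :=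
  AddMonoidAlgebra k (NSemi A)

/-- The monomial `t^a` of `k[ℕA]`. -/
def mono {d : ℕ} (k : Type*) [Field k] (A : Set (Fin d → ℤ)) (a : (NSemi A)) :
    SGRing k A :=
  AddMonoidAlgebra.single a 1

/-- `I` is a monomial ideal of `k[ℕA]`: an ideal generated by monomials. -/
def IsMonomialIdeal {d : ℕ} (k : Type*) [Field k] (A : Set (Fin d → ℤ))
    (I : Ideal (SGRing k A)) : Prop :=
  ∃ S : Set (NSemi A), I = Ideal.span ((fun a => mono k A a) '' S)

/-- The exponent set `E(I) = {a ∈ ℕA : t^a ∈ I}` of an ideal of `k[ℕA]`,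
as a subset of `ℤ^d`. -/
def expSet {d : ℕ} (k : Type*) [Field k] (A : Set (Fin d → ℤ))
    (I : Ideal (SGRing k A)) : Set (Fin d → ℤ) :=
  {x | ∃ h : x ∈ NSemi A, mono k A ⟨x, h⟩ ∈ I}

/-- The monomial prime ideal `p_F = ⟨t^a : a ∈ ℕA ∖ ℕF⟩` of `k[ℕA]`. -/
def primeF {d : ℕ} (k : Type*) [Field k] (A F : Set (Fin d → ℤ)) :
    Ideal (SGRing k A) :=
  Ideal.span {x | ∃ a : (NSemi A), (a : Fin d → ℤ) ∉ NSemi F ∧ x = mono k A a}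

end


section Cone

variable {d : ℕ} {A F S : Set (Fin d → ℤ)}

lemma toR_injective : Function.Injective (toR (d := d)) := fun u v h => by
  funext i
  have := congrFun h i
  simpa [toR] using this

lemma toR_zero : toR (0 : Fin d → ℤ) = 0 := by
  funext i; simp [toR]

lemma toR_add (u v : Fin d → ℤ) : toR (u + v) = toR u + toR v := by
  funext i; simp [toR]

lemma zero_mem_cone : (0 : Fin d → ℝ) ∈ cone S :=
  ⟨∅, 0, by simp, by simp, by simp⟩

lemma toR_mem_cone {v : Fin d → ℤ} (hv : v ∈ S) : toR v ∈ cone S :=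
  ⟨{v}, fun _ => 1, by simpa using hv, by simp, by simp⟩

lemma smul_mem_cone {x : Fin d → ℝ} (hx : x ∈ cone S) {r : ℝ} (hr : 0 ≤ r) :
    r • x ∈ cone S := by
  obtain ⟨t, c, ht, hc, rfl⟩ := hx
  exact ⟨t, fun v => r * c v, ht, fun v => mul_nonneg hr (hc v), by
    simp [Finset.smul_sum, mul_smul]⟩

lemma add_mem_cone {x y : Fin d → ℝ} (hx : x ∈ cone S) (hy : y ∈ cone S) :
    x + y ∈ cone S := by
  classical
  obtain ⟨t, c, ht, hc, rfl⟩ := hx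
  obtain ⟨t', c', ht', hc', rfl⟩ := hy
  refine ⟨t ∪ t', fun v => (if v ∈ t then c v else 0) + (if v ∈ t' then c' v else 0),
    by simp [ht, ht'], fun v => ?_, ?_⟩
  · have := hc v
    have := hc' v
    positivity
  · simp only [add_smul, Finset.sum_add_distrib, ite_smul, zero_smul, Finset.sum_ite_mem]
    rw [Finset.union_inter_cancel_left, Finset.union_inter_cancel_right]

lemma toR_mem_cone_of_mem_NSemi {v : Fin d → ℤ} (hv : v ∈ NSemi S) : toR v ∈ cone S := by
  induction hv using AddSubmonoid.closure_induction with
  | mem x hx => exact toR_mem_cone hx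
  | zero => rw [toR_zero]; exact zero_mem_cone
  | add x y _ _ hx hy => rw [toR_add]; exact add_mem_cone hx hy

lemma IsFace.mem_NSemi_of_add_mem_cone (hF : IsFace A F) {u v : Fin d → ℤ}
    (hu : u ∈ NSemi A) (hv : v ∈ NSemi A) (h : toR (u + v) ∈ cone F) : u ∈ NSemi F := by
  induction hu using AddSubmonoid.closure_induction generalizing v with
  | mem a ha =>
    have hmid : (1 / 2 : ℝ) • toR (a + v) ∈ openSegment ℝ (toR a) (toR v) :=
      ⟨1 / 2, 1 / 2, by norm_num, by norm_num, by norm_num, by rw [toR_add, smul_add]⟩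
    have hcone : toR a ∈ cone F := hF.2.1.2 (toR_mem_cone ha) (toR_mem_cone_of_mem_NSemi hv)
      (smul_mem_cone h (by norm_num)) hmid
    have : toR a ∈ toR '' F := hF.2.2 ▸ ⟨hcone, Set.mem_image_of_mem _ ha⟩
    exact AddSubmonoid.subset_closure (toR_injective.mem_set_image.1 this)
  | zero => exact zero_mem _
  | add x y hx hy ihx ihy =>
    refine add_mem (ihx (add_mem hy hv) (by rwa [← add_assoc])) (ihy (add_mem hx hv) ?_)
    rwa [← add_assoc, add_comm y x]

lemma IsFace.mem_NSemi_of_add_mem (hF : IsFace A F) {u v : Fin d → ℤ}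
    (hu : u ∈ NSemi A) (hv : v ∈ NSemi A) (h : u + v ∈ NSemi F) : u ∈ NSemi F :=
  hF.mem_NSemi_of_add_mem_cone hu hv (toR_mem_cone_of_mem_NSemi h)

lemma IsFace.mem_of_mem_NSemi (hF : IsFace A F) {a : Fin d → ℤ} (ha : a ∈ A)
    (h : a ∈ NSemi F) : a ∈ F := by
  have : toR a ∈ toR '' F := hF.2.2 ▸ ⟨toR_mem_cone_of_mem_NSemi h, Set.mem_image_of_mem _ ha⟩
  exact toR_injective.mem_set_image.1 this

lemma IsFace.NSemi_le (hF : IsFace A F) : NSemi F ≤ NSemi A :=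
  AddSubmonoid.closure_mono hF.1

lemma IsConfig.eq_zero_of_add_eq_zero (hA : IsConfig A) {u v : Fin d → ℤ}
    (hu : u ∈ NSemi A) (hv : v ∈ NSemi A) (h : u + v = 0) : u = 0 := by
  refine toR_injective ?_
  rw [toR_zero]
  refine hA.pointed _ (toR_mem_cone_of_mem_NSemi hu) ?_
  have : -toR u = toR v := by
    rw [neg_eq_iff_add_eq_zero, ← toR_add, h, toR_zero]
  rw [this]
  exact toR_mem_cone_of_mem_NSemi hv

lemma self_mem_cell (a : Fin d → ℤ) : a ∈ cell a F := ⟨0, zero_mem _, by simp⟩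

lemma cell_subset_cell {a b : Fin d → ℤ} {G : Set (Fin d → ℤ)} (h : a ∈ cell b F)
    (hG : G ⊆ F) : cell a G ⊆ cell b F := by
  rintro _ ⟨g, hg, rfl⟩
  obtain ⟨f, hf, rfl⟩ := h
  exact ⟨f + g, add_mem hf (AddSubmonoid.closure_mono hG hg), by abel⟩

end Cone

section Irreducible

open AddMonoidAlgebra

variable {k M : Type*} [Field k] [AddCommMonoid M]

/-- The elements of `M` dividing some element of the coset `b + N`. -/
def cosetDivisors (N : AddSubmonoid M) (b : M) : Set M :=
  {c | ∃ m, ∃ f ∈ N, c + m = b + f}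

lemma mem_cosetDivisors_of_add {N : AddSubmonoid M} {b c m : M}
    (h : c + m ∈ cosetDivisors N b) : c ∈ cosetDivisors N b := by
  obtain ⟨m', f, hf, h⟩ := h
  exact ⟨m + m', f, hf, by rw [← add_assoc, h]⟩

/-- The ideal generated by the monomials with exponents in an upper set `U` consists of the
elements supported in `U`. -/
lemma mem_span_single_image {U : Set M} (hU : ∀ c m, c ∈ U → c + m ∈ U)
    {f : AddMonoidAlgebra k M} :
    f ∈ Ideal.span ((fun a => (single a 1 : AddMonoidAlgebra k M)) '' U) ↔
      ∀ c ∈ f.coeff.support, c ∈ U := by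
  refine mem_ideal_span_of'_image.trans (forall₂_congr fun c _ => ⟨?_, fun h => ?_⟩)
  · rintro ⟨m, hm, e, rfl⟩
    rw [add_comm]
    exact hU _ _ hm
  · exact ⟨c, h, 0, by simp⟩

variable [IsCancelAdd M]

/-- An ideal properly containing the ideal of elements supported off `cosetDivisors N b`
contains a nonzero multiple of `t^b` by an element of `k[N]`. -/
lemma exists_single_mul_mem {N : AddSubmonoid M} (hN : ∀ x y, x + y ∈ N → x ∈ N) {b : M}
    {J J' : Ideal (AddMonoidAlgebra k M)}
    (hJ : ∀ f, f ∈ J ↔ ∀ c ∈ f.coeff.support, c ∉ cosetDivisors N b)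
    (hle : J ≤ J') (hne : ¬ J' ≤ J) :
    ∃ p : AddMonoidAlgebra k M, p ≠ 0 ∧ (∀ c ∈ p.coeff.support, c ∈ N) ∧
      single b 1 * p ∈ J' := by
  classical
  have hex : {f | f ∈ J' ∧ f ∉ J}.Nonempty := Set.not_subset.1 hne
  obtain ⟨f, ⟨hfJ', hfJ⟩, hmin⟩ : ∃ f, (f ∈ J' ∧ f ∉ J) ∧
      ∀ g, g ∈ J' → g ∉ J → f.coeff.support.card ≤ g.coeff.support.card := by
    obtain ⟨f, hf, h⟩ := WellFounded.has_min
      (measure fun f : AddMonoidAlgebra k M => f.coeff.support.card).wf _ hex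
    exact ⟨f, hf, fun g h1 h2 => not_lt.1 (h g ⟨h1, h2⟩)⟩
  have hsupp : ∀ g, g ∈ J' → g ∉ J → g.coeff.support.card ≤ f.coeff.support.card →
      ∀ c ∈ g.coeff.support, c ∈ cosetDivisors N b := by
    intro g hg hgJ hcard c hc
    by_contra hcD
    have hsing : single c (g.coeff c) ∈ J := by
      rw [hJ]
      intro c' hc'
      rwa [Finset.mem_singleton.1 (Finsupp.support_single_subset hc')]
    have hsum : single c (g.coeff c) + ofCoeff (g.coeff.erase c) = g :=
      coeff_injective (Finsupp.single_add_erase c g.coeff)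
    have hJ'' : ofCoeff (g.coeff.erase c) ∈ J' :=
      (Ideal.add_mem_iff_right _ (hle hsing)).1 (by rwa [hsum])
    have hnJ : ofCoeff (g.coeff.erase c) ∉ J := fun h => hgJ (by
      rw [← hsum]; exact J.add_mem hsing h)
    have h1 := hmin _ hJ'' hnJ
    rw [coeff_ofCoeff, Finsupp.support_erase] at h1
    exact absurd (Finset.card_erase_lt_of_mem hc) (by omega)
  have hcoeff : ∀ (m c : M) (g : AddMonoidAlgebra k M),
      (single m 1 * g).coeff (m + c) = g.coeff c := fun m c g => by
    rw [coeff_single_mul_eq_mul_coeff c (by simp), one_mul]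
  have hsub : ∀ (m : M) (g : AddMonoidAlgebra k M),
      (single m 1 * g).coeff.support ⊆ g.coeff.support.image (m + ·) := fun m g x hx => by
    obtain ⟨y, hy, z, hz, rfl⟩ := Finset.mem_add.1 (support_coeff_mul_subset _ _ hx)
    rw [Finset.mem_singleton.1 (Finsupp.support_single_subset hy)]
    exact Finset.mem_image_of_mem _ hz
  -- a monomial multiple of `f` outside `J` has all its exponents in `cosetDivisors N b`
  have hshift : ∀ m, ∀ c ∈ f.coeff.support, m + c ∈ cosetDivisors N b →
      ∀ c' ∈ f.coeff.support, m + c' ∈ cosetDivisors N b := by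
    intro m c hc hcD c' hc'
    refine hsupp (single m 1 * f) (J'.mul_mem_left _ hfJ') ?_ ?_ _ ?_
    · rw [hJ]
      push Not
      exact ⟨m + c, by rwa [Finsupp.mem_support_iff, hcoeff, ← Finsupp.mem_support_iff], hcD⟩
    · exact (Finset.card_le_card (hsub m f)).trans Finset.card_image_le
    · rwa [Finsupp.mem_support_iff, hcoeff, ← Finsupp.mem_support_iff]
  have hf0 : f ≠ 0 := fun h => hfJ (h ▸ J.zero_mem)
  obtain ⟨c₀, hc₀⟩ := Finsupp.support_nonempty_iff.2 (fun h => hf0 (coeff_injective h))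
  obtain ⟨m₀, f₀, hf₀, h₀⟩ := hsupp f hfJ' hfJ le_rfl c₀ hc₀
  have hcoset : ∀ c ∈ f.coeff.support, ∃ m ∈ N, ∃ g ∈ N, m₀ + c + m = b + g := by
    intro c hc
    obtain ⟨m, g, hg, h⟩ := hshift m₀ c₀ hc₀ ⟨0, f₀, hf₀, by rw [add_zero, add_comm, h₀]⟩ c hc
    refine ⟨m, ?_, g, hg, h⟩
    obtain ⟨m', g', hg', h'⟩ := hshift (m₀ + m) c hc
      ⟨0, g, hg, by rw [add_zero, ← h]; abel⟩ c₀ hc₀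
    have : m + (m' + f₀) = g' := by
      refine add_left_cancel (a := b) ?_
      rw [← h', show b + (m + (m' + f₀)) = (b + f₀) + m + m' by abel, ← h₀]
      abel
    exact hN _ (m' + f₀) (this ▸ hg')
  obtain ⟨m₁, -, hm₁⟩ : ∃ m ∈ N, ∀ c ∈ f.coeff.support, ∃ g ∈ N, m₀ + c + m = b + g := by
    revert hcoset
    generalize f.coeff.support = s
    intro hcoset
    induction s using Finset.induction_on with
    | empty => exact ⟨0, zero_mem _, by simp⟩
    | insert a s _ ih =>
      obtain ⟨m, hm, h⟩ := ih fun c hc => hcoset c (Finset.mem_insert_of_mem hc)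
      obtain ⟨m', hm', g', hg', h'⟩ := hcoset a (Finset.mem_insert_self a s)
      refine ⟨m + m', add_mem hm hm', fun c hc => ?_⟩
      obtain rfl | hc := Finset.mem_insert.1 hc
      · exact ⟨g' + m, add_mem hg' hm, by rw [← add_assoc b, ← h']; abel⟩
      · obtain ⟨g, hg, h⟩ := h c hc
        exact ⟨g + m', add_mem hg hm', by rw [← add_assoc b, ← h]; abel⟩
  have hdiv : ∀ c ∈ (single (m₀ + m₁) 1 * f).coeff.support, ∃ g ∈ N, c = b + g := by
    intro c hc
    obtain ⟨c, hc', rfl⟩ := Finset.mem_image.1 (hsub _ _ hc)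
    obtain ⟨g, hg, h⟩ := hm₁ c hc'
    exact ⟨g, hg, by rw [← h]; abel⟩
  set F := single (m₀ + m₁) 1 * f with hF
  have hmod : F.modOf b = 0 := by
    ext c
    by_cases hc : ∃ e, c = b + e
    · exact coeff_modOf_of_exists_add _ _ _ hc
    · rw [coeff_modOf_of_not_exists_add _ _ _ hc]
      by_contra h0
      obtain ⟨g, -, h⟩ := hdiv c (Finsupp.mem_support_iff.2 h0)
      exact hc ⟨g, h⟩
  have hmul : single b 1 * F.divOf b = F := by
    have := divOf_add_modOf F b
    rwa [hmod, add_zero] at this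
  refine ⟨F.divOf b, fun h => ?_, fun c hc => ?_, ?_⟩
  · rw [h, mul_zero] at hmul
    have := hcoeff (m₀ + m₁) c₀ f
    rw [← hF, ← hmul] at this
    exact Finsupp.mem_support_iff.1 hc₀ this.symm
  · obtain ⟨g, hg, h⟩ := hdiv (b + c) (by simpa using hc)
    rwa [add_left_cancel h]
  · rw [hmul]
    exact J'.mul_mem_left _ hfJ'

lemma irreducible_of_mem_iff_cosetDivisors [NoZeroDivisors (AddMonoidAlgebra k M)]
    {N : AddSubmonoid M} (hN : ∀ x y, x + y ∈ N → x ∈ N) {b : M}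
    {J : Ideal (AddMonoidAlgebra k M)}
    (hJ : ∀ f, f ∈ J ↔ ∀ c ∈ f.coeff.support, c ∉ cosetDivisors N b) :
    J ≠ ⊤ ∧ ∀ J' K' : Ideal (AddMonoidAlgebra k M), J = J' ⊓ K' → J = J' ∨ J = K' := by
  classical
  have hcos : ∀ p : AddMonoidAlgebra k M, (∀ c ∈ p.coeff.support, c ∈ N) →
      single b 1 * p ∈ J → p = 0 := by
    intro p hp h
    by_contra hp0
    obtain ⟨c, hc⟩ := Finsupp.support_nonempty_iff.2 (fun h => hp0 (coeff_injective h))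
    refine (hJ _).1 h (b + c) ?_ ⟨0, c, hp c hc, by simp⟩
    rw [Finsupp.mem_support_iff, coeff_single_mul_eq_mul_coeff c (by simp), one_mul]
    exact Finsupp.mem_support_iff.1 hc
  refine ⟨fun h => ?_, fun J' K' h => ?_⟩
  · refine one_ne_zero (hcos 1 (fun c hc => ?_) (h ▸ Submodule.mem_top))
    rw [Finset.mem_singleton.1 (Finsupp.support_single_subset hc)]
    exact zero_mem _
  · by_contra! hcon
    have hJ' : J ≤ J' := h ▸ inf_le_left
    have hK' : J ≤ K' := h ▸ inf_le_right
    obtain ⟨p, hp0, hp, hpJ⟩ := exists_single_mul_mem hN hJ hJ' fun h' =>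
      hcon.1 (le_antisymm hJ' h')
    obtain ⟨q, hq0, hq, hqK⟩ := exists_single_mul_mem hN hJ hK' fun h' =>
      hcon.2 (le_antisymm hK' h')
    refine mul_ne_zero hp0 hq0 (hcos (p * q) (fun c hc => ?_) ?_)
    · obtain ⟨y, hy, z, hz, rfl⟩ := Finset.mem_add.1 (support_coeff_mul_subset _ _ hc)
      exact add_mem (hp y hy) (hq z hz)
    · rw [h]
      refine ⟨?_, ?_⟩
      · rw [← mul_assoc]
        exact J'.mul_mem_right _ hpJ
      · rw [mul_left_comm]
        exact K'.mul_mem_left _ hqK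

end Irreducible

section Primary

variable {d : ℕ} {k : Type*} [Field k] {A F : Set (Fin d → ℤ)} {I : Ideal (SGRing k A)}

lemma isNoetherianRing_SGRing (hA : A.Finite) : IsNoetherianRing (SGRing k A) := by
  have : AddMonoid.FG (NSemi A) :=
    (AddMonoid.fg_iff_addSubmonoid_fg _).2 ((AddSubmonoid.fg_iff _).2 ⟨A, rfl, hA⟩)
  exact Algebra.FiniteType.isNoetherianRing k _

lemma noZeroDivisors_SGRing : NoZeroDivisors (SGRing k A) := by
  have : UniqueSums (NSemi A) :=
    UniqueSums.of_injective_addHom (NSemi A).subtype.toAddHom Subtype.val_injective inferInstance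
  infer_instance

lemma mono_add (x y : NSemi A) : mono k A (x + y) = mono k A x * mono k A y := by
  simp [mono, AddMonoidAlgebra.single_mul_single]

lemma mono_nsmul (n : ℕ) (x : NSemi A) : mono k A (n • x) = mono k A x ^ n := by
  simp [mono, AddMonoidAlgebra.single_pow]

lemma mono_add_mem {x : NSemi A} (h : mono k A x ∈ I) (y : NSemi A) :
    mono k A (x + y) ∈ I := by
  rw [mono_add]
  exact I.mul_mem_right _ h

lemma mono_mem_span_iff {U : Set (NSemi A)} (hU : ∀ c m, c ∈ U → c + m ∈ U) {x : NSemi A} :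
    mono k A x ∈ Ideal.span ((fun a => mono k A a) '' U) ↔ x ∈ U := by
  refine (mem_span_single_image hU).trans ?_
  simp [mono]

lemma IsMonomialIdeal.mem_iff (hI : IsMonomialIdeal k A I) {f : SGRing k A} :
    f ∈ I ↔ ∀ c ∈ f.coeff.support, mono k A c ∈ I := by
  have hspan : I = Ideal.span ((fun a => mono k A a) '' {c | mono k A c ∈ I}) := by
    obtain ⟨S, hS⟩ := hI
    refine le_antisymm ?_ (Ideal.span_le.2 (by rintro _ ⟨c, hc, rfl⟩; exact hc))
    conv_lhs => rw [hS]
    refine Ideal.span_mono (Set.image_mono fun c hc => ?_)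
    rw [Set.mem_ofPred_eq, hS]
    exact Ideal.subset_span (Set.mem_image_of_mem _ hc)
  exact (iff_of_eq (congrArg (f ∈ ·) hspan)).trans
    (mem_span_single_image fun c m h => mono_add_mem h m)

/-- `ℕF` as a submonoid of `ℕA`. -/
def faceSubmonoid (A F : Set (Fin d → ℤ)) : AddSubmonoid (NSemi A) :=
  (NSemi F).comap (NSemi A).subtype

lemma mem_faceSubmonoid {x : NSemi A} :
    x ∈ faceSubmonoid A F ↔ (x : Fin d → ℤ) ∈ NSemi F := Iff.rfl

lemma IsFace.mem_faceSubmonoid_of_add (hF : IsFace A F) (x y : NSemi A)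
    (h : x + y ∈ faceSubmonoid A F) : x ∈ faceSubmonoid A F :=
  hF.mem_NSemi_of_add_mem x.2 y.2 h

lemma IsFace.mem_cell_iff (hF : IsFace A F) {x b : NSemi A} :
    (x : Fin d → ℤ) ∈ cell (b : Fin d → ℤ) F ↔ ∃ f ∈ faceSubmonoid A F, x = b + f :=
  ⟨fun ⟨f, hf, h⟩ => ⟨⟨f, hF.NSemi_le hf⟩, hf, Subtype.ext h⟩,
    fun ⟨f, hf, h⟩ => ⟨f, hf, congrArg Subtype.val h⟩⟩

lemma mem_stdSet_iff {x : NSemi A} :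
    (x : Fin d → ℤ) ∈ stdSet A (expSet k A I) ↔ mono k A x ∉ I :=
  ⟨fun h h' => h.2 ⟨x.2, h'⟩, fun h => ⟨x.2, fun ⟨_, h'⟩ => h h'⟩⟩

lemma mono_mem_primeF_iff (hF : IsFace A F) {x : NSemi A} :
    mono k A x ∈ primeF k A F ↔ x ∉ faceSubmonoid A F := by
  have : primeF k A F =
      Ideal.span ((fun a => mono k A a) '' {a | a ∉ faceSubmonoid A F}) := by
    refine congrArg Ideal.span (Set.ext fun y => ?_)
    exact ⟨fun ⟨a, ha, h⟩ => ⟨a, ha, h.symm⟩, fun ⟨a, ha, h⟩ => ⟨a, ha, h.symm⟩⟩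
  rw [this]
  exact mono_mem_span_iff fun c m (hc : c ∉ _) h => hc (hF.mem_faceSubmonoid_of_add c m h)

lemma mono_mem_of_add_mem (hF : IsFace A F) (hprimary : I.IsPrimary)
    (hrad : I.radical = primeF k A F) {x f : NSemi A} (hf : f ∈ faceSubmonoid A F)
    (h : mono k A (x + f) ∈ I) : mono k A x ∈ I := by
  rw [mono_add, mul_comm] at h
  refine (hprimary.mem_or_mem h).resolve_right fun h' => ?_
  rw [I.colon_univ, hrad, mono_mem_primeF_iff hF] at h'
  exact h' hf

lemma exists_nsmul_mono_mem (hF : IsFace A F) (hrad : I.radical = primeF k A F)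
    {x : NSemi A} (hx : x ∉ faceSubmonoid A F) : ∃ n : ℕ, mono k A (n • x) ∈ I := by
  rw [← mono_mem_primeF_iff (k := k) hF, ← hrad] at hx
  obtain ⟨n, hn⟩ := hx
  exact ⟨n, by rwa [mono_nsmul]⟩

lemma ProperPair.face_subset (hF : IsFace A F) (hrad : I.radical = primeF k A F)
    {a : Fin d → ℤ} {G : Set (Fin d → ℤ)} (h : ProperPair A (expSet k A I) a G) : G ⊆ F := by
  intro g hg
  have hgA := h.2.1.1 hg
  by_contra hgF
  obtain ⟨n, hn⟩ := exists_nsmul_mono_mem (x := ⟨g, AddSubmonoid.subset_closure hgA⟩) hF hrad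
    fun h' => hgF (hF.mem_of_mem_NSemi hgA h')
  refine (h.2.2 ⟨n • g, nsmul_mem (AddSubmonoid.subset_closure hg) n, rfl⟩).2
    ⟨add_mem h.1 (nsmul_mem (AddSubmonoid.subset_closure hgA) n), ?_⟩
  have := mono_add_mem hn ⟨a, h.1⟩
  rwa [add_comm] at this

lemma properPair_of_mono_notMem (hF : IsFace A F) (hprimary : I.IsPrimary)
    (hrad : I.radical = primeF k A F) {x : NSemi A} (hx : mono k A x ∉ I) :
    ProperPair A (expSet k A I) x F := by
  refine ⟨x.2, hF, ?_⟩
  rintro _ ⟨f, hf, rfl⟩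
  exact (mem_stdSet_iff (x := x + ⟨f, hF.NSemi_le hf⟩)).2
    fun h => hx (mono_mem_of_add_mem hF hprimary hrad hf h)

lemma ProperPair.mono_notMem {x : NSemi A} {G : Set (Fin d → ℤ)}
    (h : ProperPair A (expSet k A I) x G) : mono k A x ∉ I :=
  mem_stdSet_iff.1 (h.2.2 (self_mem_cell _))

/-- Every standard monomial of a `p_F`-primary ideal lies in the cell of a standard pair. -/
lemma exists_stdPair (hA : IsConfig A) (hF : IsFace A F) (hprimary : I.IsPrimary)
    (hrad : I.radical = primeF k A F) {c : NSemi A} (hc : mono k A c ∉ I) :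
    ∃ a : NSemi A, ∃ f ∈ faceSubmonoid A F, c = a + f ∧ StdPair A (expSet k A I) a F := by
  have := isNoetherianRing_SGRing (k := k) hA.finite
  obtain ⟨_, ⟨a, ⟨f, hf, hcf⟩, rfl⟩, hmax⟩ := (wellFounded_gt (α := Ideal (SGRing k A))).has_min
    ((fun a => Ideal.span {mono k A a}) '' {a | ∃ f ∈ faceSubmonoid A F, c = a + f})
    ⟨_, c, ⟨0, zero_mem _, by simp⟩, rfl⟩
  refine ⟨a, f, hf, hcf, properPair_of_mono_notMem hF hprimary hrad
    fun h => hc (hcf ▸ mono_add_mem h f), fun b G hbG hsub => ?_⟩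
  have hG := hbG.face_subset hF hrad
  obtain ⟨g, hg, hab⟩ := hsub (self_mem_cell _)
  have hgF : g ∈ NSemi F := AddSubmonoid.closure_mono hG hg
  set b' : NSemi A := ⟨b, hbG.1⟩
  set g' : NSemi A := ⟨g, hF.NSemi_le hgF⟩
  have hab' : a = b' + g' := Subtype.ext hab
  have hle : Ideal.span {mono k A a} ≤ Ideal.span {mono k A b'} := by
    rw [Ideal.span_singleton_le_span_singleton, hab', mono_add]
    exact dvd_mul_right _ _
  have heq : Ideal.span {mono k A a} = Ideal.span {mono k A b'} := by
    refine hle.eq_of_not_lt fun hlt => hmax _ ⟨b', ⟨g' + f, add_mem hgF hf, ?_⟩, rfl⟩ hlt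
    rw [hcf, hab', add_assoc]
  have hmem : mono k A b' ∈ Ideal.span ((fun x => mono k A x) '' {x | ∃ m, x = a + m}) := by
    have : mono k A b' ∈ Ideal.span {mono k A a} := heq ▸ Ideal.mem_span_singleton_self _
    refine Ideal.span_mono ?_ this
    rintro _ rfl
    exact ⟨a, ⟨0, by simp⟩, rfl⟩
  rw [mono_mem_span_iff (by rintro _ m ⟨n, rfl⟩; exact ⟨n + m, by rw [add_assoc]⟩)] at hmem
  obtain ⟨m, hm⟩ := hmem
  have hgm : g' + m = 0 := by
    refine add_left_cancel (a := b') ?_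
    rw [← add_assoc, ← hab', ← hm, add_zero]
  have hg0 : g = 0 := hA.eq_zero_of_add_eq_zero g'.2 m.2 (congrArg Subtype.val hgm)
  refine cell_subset_cell ⟨0, zero_mem _, ?_⟩ hG
  rw [hab, hg0, add_zero, add_zero]

/-- Every standard monomial of a `p_F`-primary ideal divides a standard monomial which is
killed by all monomials outside `ℕF`. -/
lemma exists_add_mono_mem (hA : IsConfig A) (hF : IsFace A F)
    (hrad : I.radical = primeF k A F) {c : NSemi A} (hc : mono k A c ∉ I) :
    ∃ m, mono k A (c + m) ∉ I ∧
      ∀ x, mono k A (c + m + x) ∉ I → x ∈ faceSubmonoid A F := by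
  classical
  have := isNoetherianRing_SGRing (k := k) hA.finite
  obtain ⟨_, ⟨m, hm, rfl⟩, hmax⟩ := (wellFounded_gt (α := Ideal (SGRing k A))).has_min
    ((fun m => I.colon {mono k A (c + m)}) '' {m | mono k A (c + m) ∉ I})
    ⟨_, 0, by simpa using hc, rfl⟩
  refine ⟨m, hm, fun x hx => ?_⟩
  have hcolon : ∀ y z, mono k A (c + m + y) ∉ I → mono k A (c + m + y + z) ∈ I →
      mono k A (c + m + z) ∈ I := by
    intro y z hy hz
    have hle : I.colon {mono k A (c + m)} ≤ I.colon {mono k A (c + (m + y))} := by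
      intro p hp
      rw [Submodule.mem_colon_singleton, smul_eq_mul] at hp ⊢
      rw [← add_assoc, mono_add, ← mul_assoc]
      exact I.mul_mem_right _ hp
    have heq := hle.eq_of_not_lt fun hlt =>
      hmax _ ⟨m + y, by rwa [Set.mem_ofPred_eq, ← add_assoc], rfl⟩ hlt
    have : mono k A z ∈ I.colon {mono k A (c + m)} := by
      rw [heq, Submodule.mem_colon_singleton, smul_eq_mul, ← mono_add, add_comm z, ← add_assoc]
      exact hz
    rwa [Submodule.mem_colon_singleton, smul_eq_mul, ← mono_add, add_comm] at this
  by_contra hxF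
  have key : ∀ n : ℕ, mono k A (c + m + n • x) ∉ I := by
    intro n
    induction n with
    | zero => simpa using hm
    | succ n ih =>
      intro h
      rw [succ_nsmul, ← add_assoc] at h
      exact hx (hcolon _ _ ih h)
  obtain ⟨n, hn⟩ := exists_nsmul_mono_mem hF hrad hxF
  exact key n (by rw [add_comm]; exact mono_add_mem hn _)

/-- Every standard monomial of a `p_F`-primary ideal divides an element of the cell of a
standard pair whose overlap class is maximal with respect to divisibility. -/
lemma exists_maxClass (hA : IsConfig A) (hF : IsFace A F) (hprimary : I.IsPrimary)
    (hrad : I.radical = primeF k A F) {c : NSemi A} (hc : mono k A c ∉ I) :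
    ∃ a : NSemi A, c ∈ cosetDivisors (faceSubmonoid A F) a ∧
      StdPair A (expSet k A I) a F ∧ MaxClass A (expSet k A I) a F := by
  obtain ⟨m, hm, hmax⟩ := exists_add_mono_mem hA hF hrad hc
  obtain ⟨a, f, hf, hcm, ha⟩ := exists_stdPair hA hF hprimary hrad hm
  refine ⟨a, ⟨m, f, hf, hcm⟩, ha, ?_⟩
  rintro b G hb ⟨x, hx, hsub⟩
  have hG := hb.1.face_subset hF hrad
  have hmem := hsub (self_mem_cell _)
  have hxF : x ∈ NSemi F := by
    refine hmax ⟨x, hx⟩ fun h => ?_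
    rw [hcm, add_right_comm] at h
    exact mem_stdSet_iff.1 (hb.1.2.2 hmem) (mono_mem_of_add_mem hF hprimary hrad hf h)
  obtain ⟨g, hg, h⟩ := hmem
  refine ⟨g, hF.NSemi_le (AddSubmonoid.closure_mono hG hg), cell_subset_cell ?_ hG⟩
  exact ⟨x, hxF, h.symm⟩

lemma IsFace.pairDvd_iff (hF : IsFace A F) {a b : NSemi A} :
    PairDvd A a F b F ↔ a ∈ cosetDivisors (faceSubmonoid A F) b := by
  constructor
  · rintro ⟨m, hm, h⟩
    exact ⟨⟨m, hm⟩, hF.mem_cell_iff.1 (h (self_mem_cell _))⟩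
  · rintro ⟨m, h⟩
    exact ⟨m, m.2, cell_subset_cell (hF.mem_cell_iff.2 h) subset_rfl⟩

lemma mono_notMem_of_mem_cosetDivisors (hF : IsFace A F) (hprimary : I.IsPrimary)
    (hrad : I.radical = primeF k A F) {b c : NSemi A} (hb : mono k A b ∉ I)
    (hc : c ∈ cosetDivisors (faceSubmonoid A F) b) : mono k A c ∉ I := by
  obtain ⟨m, f, hf, h⟩ := hc
  intro h'
  have := mono_add_mem h' m
  rw [h] at this
  exact hb (mono_mem_of_add_mem hF hprimary hrad hf this)

/-- The union of the cells of the standard pairs dividing `(b, F)` consists of the divisors of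
the elements of `b + ℕF`. -/
lemma exists_stdPair_dvd_iff (hA : IsConfig A) (hF : IsFace A F) (hprimary : I.IsPrimary)
    (hrad : I.radical = primeF k A F) {b c : NSemi A} (hb : mono k A b ∉ I) :
    (∃ a, StdPair A (expSet k A I) a F ∧ PairDvd A a F b F ∧ (c : Fin d → ℤ) ∈ cell a F) ↔
      c ∈ cosetDivisors (faceSubmonoid A F) b := by
  constructor
  · rintro ⟨a, ha, hab, hca⟩
    lift a to NSemi A using ha.1.1
    obtain ⟨f, hf, rfl⟩ := hF.mem_cell_iff.1 hca
    obtain ⟨m, g, hg, h⟩ := hF.pairDvd_iff.1 hab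
    exact ⟨m, g + f, add_mem hg hf, by rw [← add_assoc, ← h, add_right_comm]⟩
  · intro hc
    obtain ⟨a, f, hf, rfl, ha⟩ := exists_stdPair hA hF hprimary hrad
      (mono_notMem_of_mem_cosetDivisors hF hprimary hrad hb hc)
    exact ⟨a, ha, hF.pairDvd_iff.2 (mem_cosetDivisors_of_add hc),
      hF.mem_cell_iff.2 ⟨f, hf, rfl⟩⟩

lemma mem_cosetDivisors_of_overlap (hF : IsFace A F) {a b : NSemi A} (h : Overlap F a b) :
    a ∈ cosetDivisors (faceSubmonoid A F) b := by
  have key : ∀ z ∈ ZGrp F, ∃ f ∈ NSemi F, ∃ g ∈ NSemi F, z + f = g := by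
    intro z hz
    induction hz using AddSubgroup.closure_induction with
    | mem x hx => exact ⟨0, zero_mem _, x, AddSubmonoid.subset_closure hx, by simp⟩
    | zero => exact ⟨0, zero_mem _, 0, zero_mem _, by simp⟩
    | add x y _ _ hx hy =>
      obtain ⟨f, hf, g, hg, h⟩ := hx
      obtain ⟨f', hf', g', hg', h'⟩ := hy
      exact ⟨f + f', add_mem hf hf', g + g', add_mem hg hg', by rw [← h, ← h']; abel⟩
    | neg x _ hx =>
      obtain ⟨f, hf, g, hg, h⟩ := hx
      exact ⟨g, hg, f, hf, by rw [← h]; abel⟩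
  obtain ⟨f, hf, g, hg, h⟩ := key _ h
  exact ⟨⟨f, hF.NSemi_le hf⟩, ⟨g, hF.NSemi_le hg⟩, hg, Subtype.ext (by
    change (a : Fin d → ℤ) + f = b + g
    rw [← h]; abel)⟩

lemma overlap_of_mem_cosetDivisors (hF : IsFace A F) {a b : NSemi A}
    (hab : a ∈ cosetDivisors (faceSubmonoid A F) b)
    (hba : b ∈ cosetDivisors (faceSubmonoid A F) a) : Overlap F a b := by
  have hle : NSemi F ≤ (ZGrp F).toAddSubmonoid :=
    AddSubmonoid.closure_le.2 AddSubgroup.subset_closure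
  obtain ⟨m, f, hf, h⟩ := hab
  obtain ⟨n, g, hg, h'⟩ := hba
  have hsum : m + n = g + f := by
    refine add_left_cancel (a := a) ?_
    rw [← add_assoc, h, add_right_comm, h', add_assoc]
  have hm := hF.mem_faceSubmonoid_of_add m n (hsum ▸ add_mem hg hf)
  have : (a : Fin d → ℤ) - b = f - m := by
    rw [sub_eq_sub_iff_add_eq_add, add_comm (f : Fin d → ℤ)]
    exact congrArg Subtype.val h
  rw [Overlap, this]
  exact sub_mem (hle hf) (hle hm)

end Primary

/-- Let `I` be a `p_F`-primary monomial ideal, with maximal overlap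
classes of standard pairs `[b 1,F],…,[b ℓ,F]` (pairwise non-overlapping representatives
enumerating all maximal classes).  Then the sets `ℕA ∖ T i` (where
`T i = {c ∈ ℕA : c ∈ b' + ℕF for some standard pair (b',F) of I whose overlap class
divides [b i,F]}`) are exponent sets of monomial ideals `J i ⊇ I`, each `J i` is
irreducible, `I = ⋂ i, J i`, and this decomposition is irredundant. -/
theorem irreducible_decomposition_of_primary {d : ℕ} (k : Type*) [Field k]
    (A : Set (Fin d → ℤ)) (hA : IsConfig A)
    (F : Set (Fin d → ℤ)) (hF : IsFace A F)
    (I : Ideal (SGRing k A)) (hI : IsMonomialIdeal k A I)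
    (hprimary : I.IsPrimary) (hrad : I.radical = primeF k A F)
    (ℓ : ℕ) (b : Fin ℓ → (Fin d → ℤ))
    (hstd : ∀ i, StdPair A (expSet k A I) (b i) F ∧ MaxClass A (expSet k A I) (b i) F)
    (hdistinct : ∀ i j, i ≠ j → ¬ Overlap F (b i) (b j))
    (hcomplete : ∀ a G, StdPair A (expSet k A I) a G → MaxClass A (expSet k A I) a G →
      ∃ i, G = F ∧ Overlap F a (b i)) :
    ∃ J : Fin ℓ → Ideal (SGRing k A),
      (∀ i, IsMonomialIdeal k A (J i) ∧
        (∀ c, ∀ hc : c ∈ NSemi A, (mono k A ⟨c, hc⟩ ∉ J i ↔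
          ∃ b', StdPair A (expSet k A I) b' F ∧ PairDvd A b' F (b i) F ∧
            c ∈ cell b' F)) ∧
        I ≤ J i ∧
        (J i ≠ ⊤ ∧ ∀ J' K' : Ideal (SGRing k A), J i = J' ⊓ K' → J i = J' ∨ J i = K')) ∧
      I = ⨅ i, J i ∧
      (∀ i, ¬ (⨅ j ∈ ({j | j ≠ i} : Set (Fin ℓ)), J j) ≤ J i) := by
  have hbA : ∀ i, b i ∈ NSemi A := fun i => (hstd i).1.1.1
  lift b to Fin ℓ → NSemi A using hbA
  have hb : ∀ i, mono k A (b i) ∉ I := fun i => (hstd i).1.1.mono_notMem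
  set D : Fin ℓ → Set (NSemi A) := fun i => cosetDivisors (faceSubmonoid A F) (b i)
  have hup : ∀ i c m, c ∈ (D i)ᶜ → c + m ∈ (D i)ᶜ := fun i c m hc h =>
    hc (mem_cosetDivisors_of_add h)
  let J : Fin ℓ → Ideal (SGRing k A) := fun i =>
    Ideal.span ((fun a => mono k A a) '' (D i)ᶜ)
  have hJ : ∀ i f, f ∈ J i ↔ ∀ c ∈ f.coeff.support, c ∉ D i := fun i f =>
    mem_span_single_image (hup i)
  have hmono : ∀ i c, mono k A c ∈ J i ↔ c ∉ D i := fun i c => mono_mem_span_iff (hup i)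
  have hIJ : ∀ i, I ≤ J i := fun i f hf => (hJ i f).2 fun c hc hcD =>
    mono_notMem_of_mem_cosetDivisors hF hprimary hrad (hb i) hcD (hI.mem_iff.1 hf c hc)
  have hself : ∀ i, b i ∈ D i := fun i => ⟨0, 0, zero_mem _, rfl⟩
  have := noZeroDivisors_SGRing (k := k) (A := A)
  refine ⟨J, fun i => ⟨⟨_, rfl⟩, fun c hc => ?_, hIJ i,
    irreducible_of_mem_iff_cosetDivisors hF.mem_faceSubmonoid_of_add (hJ i)⟩,
    le_antisymm (le_iInf hIJ) fun f hf => hI.mem_iff.2 fun c hc => ?_, fun i hle => ?_⟩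
  · rw [hmono, not_not, ← exists_stdPair_dvd_iff hA hF hprimary hrad (hb i)]
  · by_contra hcI
    obtain ⟨a, hca, ha, hmax⟩ := exists_maxClass hA hF hprimary hrad hcI
    obtain ⟨i, -, hov⟩ := hcomplete a F ha hmax
    refine (hJ i f).1 (Submodule.mem_iInf _ |>.1 hf i) c hc ?_
    obtain ⟨m, g, hg, h⟩ := hca
    refine mem_cosetDivisors_of_add (m := m) ?_
    obtain ⟨m', g', hg', h'⟩ := mem_cosetDivisors_of_overlap hF hov
    exact ⟨m', g' + g, add_mem hg' hg, by rw [h, add_right_comm, h', add_assoc]⟩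
  · refine (hmono i (b i)).1 (hle ?_) (hself i)
    simp only [Submodule.mem_iInf]
    refine fun j hj => (hmono j (b i)).2 fun hij => hdistinct i j (Ne.symm hj) ?_
    exact overlap_of_mem_cosetDivisors hF hij
      (hF.pairDvd_iff.1 ((hstd i).2 _ _ (hstd j).1 (hF.pairDvd_iff.2 hij)))

end StdPairsPaper
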